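/- arXiv:math/0212276 — 7 statements merged into one kernel-verified Lean document; each statement's English description precedes it below -/
import Mathlib

section
/- Let V, V' and W be finitely generated R-modules. If V ⊕ W ≅ V' ⊕ W as R-modules, then V ≅ V' as R-modules. -/
namespace LinearEquiv

variable {R : Type*} [Ring R]

/-- If the `W → W` component of an isomorphism `V × W ≃ V' × W` is bijective, then `V ≃ V'`. -/
theorem nonempty_of_prod_of_bijective {V V' W : Type*}
    [AddCommGroup V] [Module R V] [AddCommGroup V'] [Module R V'] [AddCommGroup W] [Module R W]
    (e : (V × W) ≃ₗ[R] (V' × W)) (he : Function.Bijective fun w : W => (e (0, w)).2) :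
    Nonempty (V ≃ₗ[R] V') := by
  let f : V' →ₗ[R] V := LinearMap.fst R V W ∘ₗ e.symm.toLinearMap ∘ₗ LinearMap.inl R V' W
  have hf (v' : V') : f v' = (e.symm (v', 0)).1 := rfl
  refine ⟨(LinearEquiv.ofBijective f ⟨?_, fun v => ?_⟩).symm⟩
  · rw [injective_iff_map_eq_zero]
    intro v' hv'
    have h : e (0, (e.symm (v', 0)).2) = (v', 0) := by
      have h' : ((0, (e.symm (v', 0)).2) : V × W) = e.symm (v', 0) := Prod.ext hv'.symm rfl
      rw [h', e.apply_symm_apply]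
    have hw : (e.symm (v', 0)).2 = 0 := he.1 (by simp [h, ← Prod.zero_eq_mk])
    rw [hw, ← Prod.zero_eq_mk, map_zero] at h
    exact (congrArg Prod.fst h).symm
  · obtain ⟨w, hw⟩ := he.2 (-(e (v, 0)).2)
    have h : e (v, w) = ((e (v, w)).1, 0) := by
      refine Prod.ext rfl ?_
      have hvw : (v, w) = (v, 0) + (0, w) := by simp
      rw [hvw, map_add, Prod.snd_add]
      simp only at hw
      simp [hw]
    refine ⟨(e (v, w)).1, ?_⟩
    rw [hf, ← h, e.symm_apply_apply]

/-- A module all of whose endomorphisms are nilpotent or bijective can be cancelled. -/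
theorem nonempty_of_prod_of_isNilpotent_or_bijective {V V' W : Type*}
    [AddCommGroup V] [Module R V] [AddCommGroup V'] [Module R V'] [AddCommGroup W] [Module R W]
    (hW : ∀ f : Module.End R W, IsNilpotent f ∨ Function.Bijective f)
    (e : (V × W) ≃ₗ[R] (V' × W)) : Nonempty (V ≃ₗ[R] V') := by
  let c : V →ₗ[R] W := LinearMap.snd R V' W ∘ₗ e.toLinearMap ∘ₗ LinearMap.inl R V W
  let d : Module.End R W := LinearMap.snd R V' W ∘ₗ e.toLinearMap ∘ₗ LinearMap.inr R V W
  let b' : W →ₗ[R] V := LinearMap.fst R V W ∘ₗ e.symm.toLinearMap ∘ₗ LinearMap.inr R V' W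
  have hcd (v : V) (w : W) : (e (v, w)).2 = c v + d w := by
    have hvw : (v, w) = (v, 0) + (0, w) := by simp
    rw [hvw, map_add]
    rfl
  rcases hW d with hd | hd
  swap
  · exact nonempty_of_prod_of_bijective e hd
  let d' : Module.End R W := LinearMap.snd R V W ∘ₗ e.symm.toLinearMap ∘ₗ LinearMap.inr R V' W
  have hsum : c ∘ₗ b' = 1 - d * d' := by
    refine eq_sub_of_add_eq (LinearMap.ext fun w => ?_)
    have h := hcd (b' w) (d' w)
    have h' : (b' w, d' w) = e.symm (0, w) := rfl
    rw [h', e.apply_symm_apply] at h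
    exact h.symm
  have hu : IsUnit (c ∘ₗ b' : Module.End R W) := by
    rw [hsum]
    rcases hW (d * d') with h | h
    · exact h.isUnit_one_sub
    · have hs : Function.Surjective d := Function.Surjective.of_comp (g := d') h.2
      obtain ⟨n, hn⟩ := hd
      have hsn : Function.Surjective (d ^ n) := by
        rw [Module.End.coe_pow]
        exact hs.iterate n
      have : Subsingleton W := ⟨fun x y => by
        obtain ⟨x, rfl⟩ := hsn x
        obtain ⟨y, rfl⟩ := hsn y
        simp [hn]⟩
      exact isUnit_of_subsingleton _
  obtain ⟨u, hu⟩ := hu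
  let x : W →ₗ[R] V := b' ∘ₗ ((↑u⁻¹ : Module.End R W) * (1 - d))
  have hx (w : W) : c (x w) + d w = w := by
    have h : (c ∘ₗ b') * (↑u⁻¹ * (1 - d)) + d = 1 := by
      rw [← hu, Units.mul_inv_cancel_left, sub_add_cancel]
    exact LinearMap.congr_fun h w
  let s : (V × W) ≃ₗ[R] (V × W) :=
    { toFun := fun p => (p.1 + x p.2, p.2)
      invFun := fun p => (p.1 - x p.2, p.2)
      map_add' := fun p q => by simp [add_add_add_comm]
      map_smul' := fun r p => by simp
      left_inv := fun p => by simp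
      right_inv := fun p => by simp }
  refine nonempty_of_prod_of_bijective (s.trans e) ?_
  have h : (fun w : W => ((s.trans e) (0, w)).2) = id := by
    funext w
    have hs : s (0, w) = (x w, w) := by simp [s]
    rw [LinearEquiv.trans_apply, hs, hcd, hx, id]
  rw [h]
  exact Function.bijective_id

end LinearEquiv

/-- An endomorphism of a module of finite length that is neither nilpotent nor bijective yields a
decomposition of the module into two proper submodules. -/
theorem Module.End.exists_isCompl_ne_top {R W : Type*} [Ring R] [AddCommGroup W] [Module R W]
    [IsNoetherian R W] [IsArtinian R W] (f : Module.End R W)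
    (hnil : ¬ IsNilpotent f) (hbij : ¬ Function.Bijective f) :
    ∃ A B : Submodule R W, IsCompl A B ∧ A ≠ ⊤ ∧ B ≠ ⊤ := by
  obtain ⟨n, hn⟩ := Filter.eventually_atTop.1 f.eventually_isCompl_ker_pow_range_pow
  refine ⟨_, _, hn (n + 1) n.le_succ, fun h => hnil ⟨n + 1, LinearMap.ker_eq_top.1 h⟩, fun h => ?_⟩
  have hs : Function.Surjective f := by
    have h' := LinearMap.range_eq_top.1 h
    rw [pow_succ'] at h'
    exact Function.Surjective.of_comp (g := f ^ n) h'
  exact hbij (IsNoetherian.bijective_of_surjective_endomorphism f hs)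

/-- A module of finite length can be cancelled from direct sums. -/
theorem LinearEquiv.nonempty_of_prod_of_finite_length.{u} {R : Type*} [Ring R] {V V' W : Type u}
    [AddCommGroup V] [Module R V] [AddCommGroup V'] [Module R V'] [AddCommGroup W] [Module R W]
    [IsNoetherian R W] [IsArtinian R W] (e : (V × W) ≃ₗ[R] (V' × W)) :
    Nonempty (V ≃ₗ[R] V') := by
  induction h : Module.length R W using WellFoundedLT.induction generalizing V V' W with
  | ind l ih =>
    by_cases hW : ∀ f : Module.End R W, IsNilpotent f ∨ Function.Bijective f
    · exact nonempty_of_prod_of_isNilpotent_or_bijective hW e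
    push Not at hW
    obtain ⟨f, hnil, hbij⟩ := hW
    obtain ⟨A, B, hAB, hA, hB⟩ := f.exists_isCompl_ne_top hnil hbij
    let w : (A × B) ≃ₗ[R] W := Submodule.prodEquivOfIsCompl A B hAB
    let e' : ((V × A) × B) ≃ₗ[R] ((V' × A) × B) :=
      prodAssoc R V A B ≪≫ₗ (refl R V).prodCongr w ≪≫ₗ e ≪≫ₗ
        (refl R V').prodCongr w.symm ≪≫ₗ (prodAssoc R V' A B).symm
    obtain ⟨g⟩ := ih _ (h ▸ Submodule.length_lt hB) e' rfl
    exact ih _ (h ▸ Submodule.length_lt hA) g rfl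

/-- **Krull–Schmidt cancellation.**
Let `k` be an algebraically closed field and `R` a finite-dimensional associative unital
`k`-algebra.  If `V`, `V'` and `W` are finitely generated `R`-modules with
`V ⊕ W ≅ V' ⊕ W` as `R`-modules, then `V ≅ V'` as `R`-modules. -/
theorem cancellation_of_direct_summand
    (k : Type) [Field k] [IsAlgClosed k]
    (R : Type) [Ring R] [Algebra k R] [FiniteDimensional k R]
    (V V' W : Type)
    [AddCommGroup V] [Module R V] [Module.Finite R V]
    [AddCommGroup V'] [Module R V'] [Module.Finite R V']
    [AddCommGroup W] [Module R W] [Module.Finite R W]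
    (h : Nonempty ((V × W) ≃ₗ[R] (V' × W))) :
    Nonempty (V ≃ₗ[R] V') := by
  have : IsArtinianRing R := IsArtinianRing.of_finite k R
  obtain ⟨e⟩ := h
  exact e.nonempty_of_prod_of_finite_length
end

section
/- Assume R has finite representation type. Then two finitely generated R-modules V and V' are isomorphic if and only if for every finitely generated R-module W the k-dimensions of the Hom-spaces agree: dim_k Hom_R(W, V) = dim_k Hom_R(W, V'). -/
/-- An `R`-module is *indecomposable* if it is nonzero and is not isomorphic to a direct
sum of two nonzero `R`-modules. -/
def IsIndecomposableModule (R : Type*) [Ring R] (V : Type*) [AddCommGroup V] [Module R V] :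
    Prop :=
  Nontrivial V ∧
    ∀ (A B : Type) [AddCommGroup A] [AddCommGroup B] [Module R A] [Module R B],
      Nontrivial A → Nontrivial B → IsEmpty (V ≃ₗ[R] (A × B))

/-- `R` has *finite representation type* if there are, up to isomorphism, only finitely
many indecomposable finitely generated `R`-modules. -/
def HasFiniteRepresentationType (R : Type) [Ring R] : Prop :=
  ∃ (n : ℕ) (M : Fin n → ModuleCat.{0} R),
    ∀ (V : Type) [AddCommGroup V] [Module R V] [Module.Finite R V],
      IsIndecomposableModule R V → ∃ i : Fin n, Nonempty (V ≃ₗ[R] M i)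

/-- A retract of a module is a direct summand, complemented by the kernel of the retraction. -/
def LinearEquiv.prodKerOfComp {R V U : Type*} [Ring R] [AddCommGroup V] [Module R V]
    [AddCommGroup U] [Module R U] (i : U →ₗ[R] V) (p : V →ₗ[R] U) (h : p ∘ₗ i = LinearMap.id) :
    V ≃ₗ[R] U × LinearMap.ker p :=
  have hi : ∀ u, p (i u) = u := LinearMap.congr_fun h
  LinearEquiv.ofLinearMap
    (p.prod ((LinearMap.id - i ∘ₗ p).codRestrict (LinearMap.ker p) fun v => by simp [hi]))
    (i.coprod (LinearMap.ker p).subtype)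
    (by
      refine LinearMap.ext fun x => ?_
      have hx : p x.2 = 0 := x.2.2
      ext <;> simp [hi, hx])
    (by ext; simp)

/-- By Fitting's lemma, a nonzero module of finite length whose endomorphisms have no nontrivial
Fitting decomposition has a local endomorphism ring. -/
theorem Module.End.isLocalRing_of_ker_pow {R V : Type*} [Ring R] [AddCommGroup V] [Module R V]
    [IsNoetherian R V] [IsArtinian R V] [Nontrivial V]
    (h : ∀ (f : Module.End R V) (n : ℕ),
      IsCompl (LinearMap.ker (f ^ n)) (LinearMap.range (f ^ n)) →
        LinearMap.ker (f ^ n) = ⊥ ∨ LinearMap.ker (f ^ n) = ⊤) :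
    IsLocalRing (Module.End R V) := by
  refine ⟨fun {a b} hab => ?_⟩
  obtain ⟨n, hn, hn0⟩ :=
    (a.eventually_isCompl_ker_pow_range_pow.and (Filter.eventually_ge_atTop 1)).exists
  rcases h a n hn with hbot | htop
  · left
    have hrange : LinearMap.range (a ^ n) = ⊤ := by simpa [hbot] using hn.sup_eq_top
    have hu : IsUnit (a ^ n) := (Module.End.isUnit_iff _).2
      ⟨LinearMap.ker_eq_bot.1 hbot, LinearMap.range_eq_top.1 hrange⟩
    exact (isUnit_pow_iff (by omega)).1 hu
  · right
    have hnil : IsNilpotent a := ⟨n, LinearMap.ker_eq_top.1 htop⟩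
    rw [← eq_sub_iff_add_eq'] at hab
    exact hab ▸ hnil.isUnit_one_sub

/-- A nonzero module of finite dimension over a field has a direct summand with local
endomorphism ring. -/
theorem exists_retract_isLocalRing (k : Type*) [Field k] (R : Type*) [Ring R] [Algebra k R]
    (V : Type) [AddCommGroup V] [Module R V] [Module k V] [IsScalarTower k R V]
    [FiniteDimensional k V] [Nontrivial V] :
    ∃ (U : Submodule R V) (p : V →ₗ[R] U), p ∘ₗ U.subtype = LinearMap.id ∧
      IsLocalRing (Module.End R U) := by
  have : IsNoetherian R V := isNoetherian_of_tower k inferInstance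
  have : IsArtinian R V := isArtinian_of_tower k inferInstance
  obtain ⟨U, ⟨hU, p, hp⟩, hmin⟩ := (wellFounded_lt (α := Submodule R V)).has_min
    {U | U ≠ ⊥ ∧ ∃ p : V →ₗ[R] U, p ∘ₗ U.subtype = LinearMap.id}
    ⟨⊤, top_ne_bot, LinearMap.codRestrict ⊤ LinearMap.id (fun _ => trivial), rfl⟩
  have : Nontrivial U := Submodule.nontrivial_iff_ne_bot.2 hU
  refine ⟨U, p, hp, Module.End.isLocalRing_of_ker_pow fun f n hc => ?_⟩
  by_contra! hne
  set K := LinearMap.ker (f ^ n)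
  have hinj := U.injective_subtype
  refine hmin (K.map U.subtype) ⟨fun hK => hne.1 (Submodule.map_injective_of_injective hinj (by simpa using hK)),
    (K.equivMapOfInjective U.subtype hinj).toLinearMap ∘ₗ K.projectionOnto _ hc ∘ₗ p, ?_⟩ ?_
  · refine LinearMap.ext fun x => ?_
    obtain ⟨y, rfl⟩ := (K.equivMapOfInjective U.subtype hinj).surjective x
    have hy : p (y : U) = y := LinearMap.congr_fun hp (y : U)
    simp [hy]
  · refine lt_of_le_of_ne (Submodule.map_subtype_le U K) fun heq => hne.2 ?_
    refine Submodule.map_injective_of_injective hinj ?_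
    rw [heq, Submodule.map_top, Submodule.range_subtype]

/-- A module with local endomorphism ring which is a retract of a finite power of `V` is
already a retract of `V`. -/
theorem exists_retract_of_retract_pi {R U V ι : Type*} [Ring R] [AddCommGroup V] [Module R V]
    [AddCommGroup U] [Module R U] [IsLocalRing (Module.End R U)] [Fintype ι]
    (f : U →ₗ[R] ι → V) (g : (ι → V) →ₗ[R] U) (h : g ∘ₗ f = LinearMap.id) :
    ∃ (i : U →ₗ[R] V) (p : V →ₗ[R] U), p ∘ₗ i = LinearMap.id := by
  classical
  let c : ι → Module.End R U := fun j =>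
    (g ∘ₗ LinearMap.single R (fun _ => V) j) ∘ₗ (LinearMap.proj j ∘ₗ f)
  have hsum : ∑ j, c j = 1 := by
    ext u
    have hu := LinearMap.congr_fun h u
    rw [LinearMap.comp_apply, LinearMap.id_apply] at hu
    simp only [c, LinearMap.sum_apply, LinearMap.comp_apply, LinearMap.proj_apply,
      LinearMap.coe_single, Module.End.one_apply, ← map_sum, Finset.univ_sum_single]
    exact hu
  obtain ⟨j, -, ⟨u, hu⟩⟩ := IsLocalRing.exists_of_isUnit_sum (hsum ▸ isUnit_one)
  refine ⟨LinearMap.proj j ∘ₗ f,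
    (↑u⁻¹ : Module.End R U) ∘ₗ (g ∘ₗ LinearMap.single R (fun _ => V) j), ?_⟩
  have := u.inv_mul
  rw [hu] at this
  exact this

section

variable {k : Type*} [Field k] {R : Type*} [Ring R] [Algebra k R]

/-- Modules which are finite-dimensional over `k` have finite-dimensional spaces of linear maps. -/
theorem finiteDimensional_linearMap (W V : Type*) [AddCommGroup W] [Module R W]
    [Module k W] [IsScalarTower k R W] [FiniteDimensional k W] [AddCommGroup V] [Module R V]
    [Module k V] [IsScalarTower k R V] [FiniteDimensional k V] :
    FiniteDimensional k (W →ₗ[R] V) :=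
  FiniteDimensional.of_injective (LinearMap.restrictScalarsₗ k R W V k)
    (LinearMap.restrictScalars_injective k)

/-- Postcomposition with an isomorphism, as a `k`-linear isomorphism of spaces of maps. -/
def LinearEquiv.postcompHom (W : Type*) {V V' : Type*} [AddCommGroup W] [Module R W]
    [AddCommGroup V] [Module R V] [Module k V] [IsScalarTower k R V]
    [AddCommGroup V'] [Module R V'] [Module k V'] [IsScalarTower k R V']
    (e : V ≃ₗ[R] V') : (W →ₗ[R] V) ≃ₗ[k] (W →ₗ[R] V') where
  toFun f := e.toLinearMap ∘ₗ f
  invFun f := e.symm.toLinearMap ∘ₗ f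
  map_add' f g := LinearMap.comp_add _ _ _
  map_smul' c f := LinearMap.ext fun x => (e.toLinearMap.restrictScalars k).map_smul c (f x)
  left_inv f := by ext; simp
  right_inv f := by ext; simp

/-- The dimension of `Hom(W, -)` is additive on direct sums. -/
theorem finrank_hom_eq_add (W V U A : Type*) [AddCommGroup W] [Module R W]
    [Module k W] [IsScalarTower k R W] [FiniteDimensional k W]
    [AddCommGroup V] [Module R V] [Module k V] [IsScalarTower k R V]
    [AddCommGroup U] [Module R U] [Module k U] [IsScalarTower k R U] [FiniteDimensional k U]
    [AddCommGroup A] [Module R A] [Module k A] [IsScalarTower k R A] [FiniteDimensional k A]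
    (e : V ≃ₗ[R] U × A) :
    Module.finrank k (W →ₗ[R] V) =
      Module.finrank k (W →ₗ[R] U) + Module.finrank k (W →ₗ[R] A) := by
  have := finiteDimensional_linearMap (k := k) (R := R) W U
  have := finiteDimensional_linearMap (k := k) (R := R) W A
  rw [(e.postcompHom (k := k) W).finrank_eq, ← (LinearMap.prodEquiv k).finrank_eq,
    Module.finrank_prod]

/-- Left exactness of `Hom(-, X)`, in terms of dimensions. -/
theorem finrank_range_lcomp_add {V F : Type*} (X : Type*)
    [AddCommGroup V] [Module R V]
    [AddCommGroup F] [Module R F] [Module k F] [IsScalarTower k R F] [FiniteDimensional k F]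
    [AddCommGroup X] [Module R X] [Module k X] [IsScalarTower k R X] [FiniteDimensional k X]
    (f : V →ₗ[R] F) :
    Module.finrank k (LinearMap.range (LinearMap.lcomp k X f)) +
      Module.finrank k ((F ⧸ LinearMap.range f) →ₗ[R] X) = Module.finrank k (F →ₗ[R] X) := by
  have := finiteDimensional_linearMap (k := k) (R := R) F X
  rw [← LinearMap.finrank_range_add_finrank_ker (LinearMap.lcomp k X f)]
  congr 1
  have hinj : Function.Injective (LinearMap.lcomp k X (LinearMap.range f).mkQ) := fun a b hab =>
    Submodule.linearMap_qext _ hab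
  rw [← LinearMap.finrank_range_of_inj hinj]
  suffices hexact : LinearMap.range (LinearMap.lcomp k X (LinearMap.range f).mkQ) =
      LinearMap.ker (LinearMap.lcomp k X f) by rw [hexact]
  ext φ
  rw [LinearMap.mem_range, LinearMap.mem_ker]
  constructor
  · rintro ⟨ψ, rfl⟩
    ext v
    exact (congrArg ψ ((Submodule.Quotient.mk_eq_zero _).2 ⟨v, rfl⟩)).trans (map_zero ψ)
  · intro h
    have hle : LinearMap.range f ≤ LinearMap.ker φ := by
      rintro _ ⟨v, rfl⟩
      exact LinearMap.congr_fun h v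
    exact ⟨(LinearMap.range f).liftQ φ hle, Submodule.liftQ_mkQ _ _ hle⟩

/-- If `Hom(W, V)` and `Hom(W, V')` always have the same dimension, then `V` is a direct summand
of a finite power of `V'`. -/
theorem exists_retract_pi_of_finrank_hom_eq
    (V V' : Type) [AddCommGroup V] [Module R V] [Module k V] [IsScalarTower k R V]
    [FiniteDimensional k V] [AddCommGroup V'] [Module R V'] [Module k V'] [IsScalarTower k R V']
    [FiniteDimensional k V']
    (h : ∀ (W : Type) [AddCommGroup W] [Module R W] [Module.Finite R W],
      Module.finrank k (W →ₗ[R] V) = Module.finrank k (W →ₗ[R] V')) :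
    ∃ (n : ℕ) (f : V →ₗ[R] Fin n → V') (g : (Fin n → V') →ₗ[R] V), g ∘ₗ f = LinearMap.id := by
  have : Module.Finite R V := Module.Finite.of_restrictScalars_finite k R V
  have : Module.Finite R V' := Module.Finite.of_restrictScalars_finite k R V'
  have := finiteDimensional_linearMap (k := k) (R := R) V V'
  have := finiteDimensional_linearMap (k := k) (R := R) V V
  let b := Module.finBasis k (V →ₗ[R] V')
  let f := LinearMap.pi fun i => b i
  have hsurj : LinearMap.range (LinearMap.lcomp k V' f) = ⊤ := by
    rw [eq_top_iff, ← b.span_eq, Submodule.span_le]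
    rintro _ ⟨i, rfl⟩
    exact ⟨LinearMap.proj i, rfl⟩
  have h1 := finrank_range_lcomp_add (k := k) V' f
  have h2 := finrank_range_lcomp_add (k := k) V f
  rw [hsurj, finrank_top] at h1
  have htop : LinearMap.range (LinearMap.lcomp k V f) = ⊤ := by
    apply Submodule.eq_top_of_finrank_eq
    have hV := h V
    have hF := h (Fin (Module.finrank k (V →ₗ[R] V')) → V')
    have hC := h ((Fin (Module.finrank k (V →ₗ[R] V')) → V') ⧸ LinearMap.range f)
    omega
  obtain ⟨g, hg⟩ := LinearMap.range_eq_top.1 htop LinearMap.id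
  exact ⟨_, f, g, hg⟩

/-- Finite-dimensional modules are determined by the dimensions of the spaces of maps into them
(Auslander, Bongartz). -/
theorem nonempty_linearEquiv_of_finrank_hom_eq [FiniteDimensional k R]
    (V V' : Type) [AddCommGroup V] [Module R V] [Module k V] [IsScalarTower k R V]
    [FiniteDimensional k V] [AddCommGroup V'] [Module R V'] [Module k V'] [IsScalarTower k R V']
    [FiniteDimensional k V']
    (h : ∀ (W : Type) [AddCommGroup W] [Module R W] [Module.Finite R W],
      Module.finrank k (W →ₗ[R] V) = Module.finrank k (W →ₗ[R] V')) :
    Nonempty (V ≃ₗ[R] V') := by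
  induction hd : Module.finrank k V using Nat.strong_induction_on generalizing V V' with
  | _ d ih =>
  have : Module.Finite R V' := Module.Finite.of_restrictScalars_finite k R V'
  obtain hV | hV := subsingleton_or_nontrivial V
  · have : Subsingleton V' := by
      have := finiteDimensional_linearMap (k := k) (R := R) V' V'
      have h0 : Module.finrank k (V' →ₗ[R] V') = 0 := by
        rw [← h V']
        exact Module.finrank_zero_of_subsingleton
      have := Module.finrank_zero_iff.1 h0
      have hid (x : V') : x = 0 :=
        LinearMap.congr_fun (Subsingleton.elim (LinearMap.id : V' →ₗ[R] V') 0) x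
      exact ⟨fun x y => (hid x).trans (hid y).symm⟩
    exact ⟨LinearEquiv.ofSubsingleton V V'⟩
  obtain ⟨U, p, hp, hU⟩ := exists_retract_isLocalRing k R V
  obtain ⟨n, f, g, hgf⟩ := exists_retract_pi_of_finrank_hom_eq V V' h
  obtain ⟨i', p', hp'⟩ := exists_retract_of_retract_pi (f ∘ₗ U.subtype) (p ∘ₗ g) (by
    rw [LinearMap.comp_assoc, ← LinearMap.comp_assoc U.subtype, hgf, LinearMap.id_comp, hp])
  let e := LinearEquiv.prodKerOfComp U.subtype p hp
  let e' := LinearEquiv.prodKerOfComp i' p' hp'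
  have hUfin : FiniteDimensional k U := inferInstanceAs (FiniteDimensional k (U.restrictScalars k))
  have hA : FiniteDimensional k (LinearMap.ker p) :=
    inferInstanceAs (FiniteDimensional k ((LinearMap.ker p).restrictScalars k))
  have hB : FiniteDimensional k (LinearMap.ker p') :=
    inferInstanceAs (FiniteDimensional k ((LinearMap.ker p').restrictScalars k))
  have hUnt : Nontrivial U := by
    by_contra hn
    rw [not_nontrivial_iff_subsingleton] at hn
    exact one_ne_zero (α := Module.End R U) (LinearMap.ext fun x => Subsingleton.elim _ _)
  obtain ⟨eAB⟩ := ih (Module.finrank k (LinearMap.ker p)) (by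
    have h1 := (e.restrictScalars k).finrank_eq
    rw [Module.finrank_prod] at h1
    have h2 : 0 < Module.finrank k U := Module.finrank_pos
    omega) (LinearMap.ker p) (LinearMap.ker p') (by
    intro W _ _ _
    let _ : Module k W := Module.compHom W (algebraMap k R)
    have : IsScalarTower k R W := IsScalarTower.of_algebraMap_smul fun _ _ => rfl
    have : FiniteDimensional k W := Module.Finite.trans R W
    have h1 := finrank_hom_eq_add (k := k) W V _ _ e
    have h2 := finrank_hom_eq_add (k := k) W V' _ _ e'
    have h3 := h W
    omega) rfl
  exact ⟨e.trans (((LinearEquiv.refl R U).prodCongr eAB).trans e'.symm)⟩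

end

/-- Let `k` be an algebraically closed field and `R` a finite-dimensional `k`-algebra of
finite representation type.  Two finitely generated `R`-modules `V`, `V'` are isomorphic
if and only if `dim_k Hom_R(W, V) = dim_k Hom_R(W, V')` for every finitely generated
`R`-module `W`. -/
theorem iso_iff_finrank_hom_eq_of_finiteRepresentationType
    (k : Type) [Field k] [IsAlgClosed k]
    (R : Type) [Ring R] [Algebra k R] [FiniteDimensional k R]
    (hR : HasFiniteRepresentationType R)
    (V V' : Type)
    [AddCommGroup V] [Module R V] [Module.Finite R V] [Module k V] [IsScalarTower k R V]
    [AddCommGroup V'] [Module R V'] [Module.Finite R V'] [Module k V'] [IsScalarTower k R V'] :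
    Nonempty (V ≃ₗ[R] V') ↔
      ∀ (W : Type) [AddCommGroup W] [Module R W] [Module.Finite R W],
        Module.finrank k (W →ₗ[R] V) = Module.finrank k (W →ₗ[R] V') := by
  have : FiniteDimensional k V := Module.Finite.trans R V
  have : FiniteDimensional k V' := Module.Finite.trans R V'
  exact ⟨fun ⟨e⟩ W _ _ _ => (e.postcompHom W).finrank_eq,
    nonempty_linearEquiv_of_finrank_hom_eq V V'⟩
end

section
/- Let V and V' be indecomposable finitely generated R-modules which are not isomorphic. Then for every R-linear map f : V → V' and every R-linear map g : V' → V, the R-linear endomorphism id_V - g ∘ f of V is bijective. -/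
theorem IsIndecomposableModule.eq_bot_or_eq_bot_of_isCompl {R : Type*} [Ring R] {V : Type}
    [AddCommGroup V] [Module R V] (hV : IsIndecomposableModule R V) {p q : Submodule R V}
    (h : IsCompl p q) : p = ⊥ ∨ q = ⊥ := by
  by_contra! hpq
  exact (hV.2 p q ((Submodule.nontrivial_iff_ne_bot).2 hpq.1)
    ((Submodule.nontrivial_iff_ne_bot).2 hpq.2)).false (p.prodEquivOfIsCompl q h).symm

/-- Fitting's lemma: an endomorphism of an indecomposable module of finite length is either
nilpotent or bijective. -/
theorem IsIndecomposableModule.isNilpotent_or_bijective {R : Type*} [Ring R] {V : Type}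
    [AddCommGroup V] [Module R V] [IsArtinian R V] [IsNoetherian R V]
    (hV : IsIndecomposableModule R V) (e : Module.End R V) :
    IsNilpotent e ∨ Function.Bijective e := by
  obtain ⟨n, hn, hc⟩ := ((Filter.eventually_ge_atTop 1).and
    (LinearMap.eventually_isCompl_ker_pow_range_pow e)).exists
  rcases hV.eq_bot_or_eq_bot_of_isCompl hc with hk | hr
  · right
    apply IsArtinian.bijective_of_injective_endomorphism
    refine Function.Injective.of_comp (f := ⇑(e ^ (n - 1))) ?_
    rw [← Module.End.coe_mul, ← pow_succ, Nat.sub_add_cancel hn]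
    exact LinearMap.ker_eq_bot.1 hk
  · exact .inl ⟨n, LinearMap.range_eq_bot.1 hr⟩

/-- Let `k` be an algebraically closed field, `R` a finite-dimensional `k`-algebra, and
`V`, `V'` two non-isomorphic indecomposable finitely generated `R`-modules.  Then for all
`R`-linear maps `f : V → V'` and `g : V' → V`, the endomorphism `id_V - g ∘ f` of `V` is
bijective. -/
theorem bijective_id_sub_comp_of_indecomposable_not_iso
    (k : Type) [Field k] [IsAlgClosed k]
    (R : Type) [Ring R] [Algebra k R] [FiniteDimensional k R]
    (V V' : Type) [AddCommGroup V] [Module R V] [Module.Finite R V]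
    [AddCommGroup V'] [Module R V'] [Module.Finite R V']
    (hV : IsIndecomposableModule R V) (hV' : IsIndecomposableModule R V')
    (hne : IsEmpty (V ≃ₗ[R] V'))
    (f : V →ₗ[R] V') (g : V' →ₗ[R] V) :
    Function.Bijective ⇑((LinearMap.id : V →ₗ[R] V) - g.comp f) := by
  have : IsArtinianRing R := IsArtinianRing.of_finite k R
  have : IsNoetherianRing R := IsNoetherianRing.of_finite k R
  have := hV.1
  rcases hV.isNilpotent_or_bijective (g ∘ₗ f) with hnil | hgf
  · exact (Module.End.isUnit_iff _).1 hnil.isUnit_one_sub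
  · have hgf' : Function.Bijective (g ∘ f) := hgf
    rcases hV'.isNilpotent_or_bijective (f ∘ₗ g) with ⟨n, hn⟩ | hfg
    · have hcomm : Function.Semiconj f (g ∘ f) (f ∘ g) := fun _ ↦ rfl
      have hinj : Function.Injective (f ∘ (g ∘ f)^[n]) :=
        hgf'.injective.of_comp.comp (hgf'.injective.iterate n)
      obtain ⟨x, hx⟩ := exists_ne (0 : V)
      refine absurd (hinj (a₁ := x) (a₂ := 0) ?_) hx
      have hzero (y : V) : f ((g ∘ f)^[n] y) = 0 := by
        rw [hcomm.iterate_right n y]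
        simpa [Module.End.pow_apply] using LinearMap.congr_fun hn (f y)
      simp only [Function.comp_apply] at hzero ⊢
      rw [hzero, hzero]
    · have hfg' : Function.Bijective (f ∘ g) := hfg
      exact (hne.false (.ofBijective f
        ⟨hgf'.injective.of_comp, hfg'.surjective.of_comp⟩)).elim
end

section
/- Assume v ≥ 1 and let H be the unique subgroup of G of index p, which is cyclic of order p^{v-1} generated by τ = σ^p; for 0 ≤ m ≤ p^{v-1} let W_m denote the k[H]-module k[H]/((τ - 1)^m). Let 1 ≤ j ≤ p^v and write j = (l-1)p + j' with 1 ≤ l ≤ p^{v-1} and 1 ≤ j' ≤ p. Then the restriction of V_j to k[H] is isomorphic, as a k[H]-module, to W_l^{⊕ j'} ⊕ W_{l-1}^{⊕ (p - j')}. -/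
/-- If the powers `1, x, …, x ^ (p - 1)` form an `R`-basis of `S` and `x ^ p = y` comes from `R`,
then `S ⧸ (x ^ (q * p + r))` with `r ≤ p` splits over `R` as a sum of `r` copies of
`R ⧸ (y ^ (q + 1))` and `p - r` copies of `R ⧸ (y ^ q)`. -/
theorem nonempty_quotient_span_pow_linearEquiv {R S : Type*} [CommRing R] [CommRing S]
    [Algebra R S] {p : ℕ} (x : S) (y : R) (hxy : algebraMap R S y = x ^ p)
    (b : Module.Basis (Fin p) R S) (hb : ∀ i, b i = x ^ (i : ℕ)) (q r : ℕ) (hr1 : 1 ≤ r)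
    (hr : r ≤ p) :
    Nonempty ((S ⧸ Ideal.span {x ^ (q * p + r)}) ≃ₗ[R]
      ((Fin r → R ⧸ Ideal.span {y ^ (q + 1)}) × (Fin (p - r) → R ⧸ Ideal.span {y ^ q}))) := by
  let f : S →ₗ[R]
      ((Fin r → R ⧸ Ideal.span {y ^ (q + 1)}) × (Fin (p - r) → R ⧸ Ideal.span {y ^ q})) :=
    LinearMap.prod
      (LinearMap.pi fun i => (Submodule.mkQ (Ideal.span {y ^ (q + 1)})).comp
        (b.coord ⟨i, by omega⟩))
      (LinearMap.pi fun i => (Submodule.mkQ (Ideal.span {y ^ q})).comp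
        (b.coord ⟨r + i, by omega⟩))
  have hmem (s : S) : f s = 0 ↔
      (∀ i : Fin p, (i : ℕ) < r → y ^ (q + 1) ∣ b.repr s i) ∧
      (∀ i : Fin p, r ≤ (i : ℕ) → y ^ q ∣ b.repr s i) := by
    simp only [f, LinearMap.prod_apply, Function.prod, Prod.mk_eq_zero, funext_iff, LinearMap.pi_apply,
      LinearMap.comp_apply, Submodule.mkQ_apply, Pi.zero_apply, Submodule.Quotient.mk_eq_zero,
      Ideal.mem_span_singleton, Module.Basis.coord_apply]
    refine and_congr ⟨fun h i hi => h ⟨i, hi⟩, fun h i => h _ i.2⟩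
      ⟨fun h i hi => ?_, fun h i => h ⟨r + i, _⟩ (Nat.le_add_right _ _)⟩
    have := h ⟨i - r, by omega⟩
    simpa [Nat.add_sub_cancel' hi] using this
  have hsurj : Function.Surjective f := by
    rintro ⟨u, w⟩
    choose u' hu using fun i => Submodule.mkQ_surjective _ (u i)
    choose w' hw using fun i => Submodule.mkQ_surjective _ (w i)
    refine ⟨b.equivFun.symm fun i => if h : (i : ℕ) < r then u' ⟨i, h⟩
      else w' ⟨i - r, by omega⟩, ?_⟩
    ext i
    · simp [f, ← hu, ← Module.Basis.equivFun_apply, -Module.Basis.equivFun_symm_apply]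
    · simp [f, ← hw, ← Module.Basis.equivFun_apply, -Module.Basis.equivFun_symm_apply]
  have hpow (n : ℕ) (hn : q * p + r ≤ n) : f (x ^ n) = 0 := by
    have hp : 0 < p := by omega
    have hn' : x ^ n = y ^ (n / p) • b ⟨n % p, Nat.mod_lt _ hp⟩ := by
      rw [hb, Algebra.smul_def, map_pow, hxy, ← pow_mul, ← pow_add, Nat.div_add_mod]
    have hq : q ≤ n / p := (Nat.le_div_iff_mul_le hp).2 (by omega)
    rw [hmem, hn']
    simp only [map_smul, Module.Basis.repr_self, Finsupp.smul_apply, smul_eq_mul,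
      Finsupp.single_apply]
    refine ⟨fun i hi => ?_, fun i _ => dvd_mul_of_dvd_left (pow_dvd_pow _ hq) _⟩
    split_ifs with h
    · refine dvd_mul_of_dvd_left (pow_dvd_pow _ ?_) _
      by_contra! hlt
      have hd := Nat.div_add_mod n p
      have hqn : n / p = q := by omega
      have hmod : n % p = i := congrArg Fin.val h
      rw [hqn, hmod, mul_comm] at hd
      omega
    · simp
  have hker : (Ideal.span {x ^ (q * p + r)}).restrictScalars R = LinearMap.ker f := by
    ext s
    rw [Submodule.restrictScalars_mem, Ideal.mem_span_singleton, LinearMap.mem_ker]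
    constructor
    · rintro ⟨t, rfl⟩
      rw [← b.sum_repr t, Finset.mul_sum, map_sum]
      refine Finset.sum_eq_zero fun i _ => ?_
      rw [mul_smul_comm, map_smul, hb, ← pow_add, hpow _ (Nat.le_add_right _ _), smul_zero]
    · intro h
      obtain ⟨h1, h2⟩ := (hmem s).1 h
      rw [← b.sum_repr s]
      refine Finset.dvd_sum fun i _ => ?_
      rw [hb, Algebra.smul_def]
      rcases lt_or_ge (i : ℕ) r with hi | hi
      · obtain ⟨c, hc⟩ := h1 i hi
        rw [hc, map_mul, map_pow, hxy, ← pow_mul, mul_assoc]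
        exact dvd_mul_of_dvd_left (pow_dvd_pow _ (by nlinarith)) _
      · obtain ⟨c, hc⟩ := h2 i hi
        rw [hc, map_mul, map_pow, hxy, ← pow_mul, mul_right_comm, ← pow_add]
        exact dvd_mul_of_dvd_left (pow_dvd_pow _ (by nlinarith)) _
  exact ⟨(Submodule.Quotient.restrictScalarsEquiv R (Ideal.span {x ^ (q * p + r)})).symm.trans
    ((Submodule.quotEquivOfEq _ _ hker).trans (f.quotKerEquivOfSurjective hsurj))⟩

/-- If `S` is generated by `x` as a `k`-algebra, `x ^ p` comes from `R`, and dimensions match, then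
`1, x, …, x ^ (p - 1)` is an `R`-basis of `S`. -/
theorem exists_basis_pow_of_finrank_eq {k R S : Type*} [Field k] [CommRing R] [CommRing S]
    [Algebra k R] [Algebra k S] [Algebra R S] [IsScalarTower k R S] [FiniteDimensional k R]
    [FiniteDimensional k S] {p : ℕ} (hp : 0 < p) (x : S) (y : R)
    (hxy : algebraMap R S y = x ^ p) (hx : Algebra.adjoin k {x} = ⊤)
    (hdim : Module.finrank k S = p * Module.finrank k R) :
    ∃ b : Module.Basis (Fin p) R S, ∀ i, b i = x ^ (i : ℕ) := by
  let f : (Fin p → R) →ₗ[R] S := Fintype.linearCombination R fun i : Fin p => x ^ (i : ℕ)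
  have hpow (n : ℕ) : x ^ n ∈ LinearMap.range f := by
    have hn : x ^ n = y ^ (n / p) • x ^ (n % p) := by
      rw [Algebra.smul_def, map_pow, hxy, ← pow_mul, ← pow_add, Nat.div_add_mod]
    rw [hn]
    refine Submodule.smul_mem _ _ ?_
    rw [Fintype.range_linearCombination]
    exact Submodule.subset_span ⟨⟨n % p, Nat.mod_lt _ hp⟩, rfl⟩
  have hsurj : Function.Surjective (f.restrictScalars k) := by
    intro s
    have hs : s ∈ Algebra.adjoin k {x} := hx ▸ Algebra.mem_top
    obtain ⟨g, rfl⟩ := (Algebra.adjoin_singleton_eq_range_aeval k x ▸ hs :)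
    change Polynomial.aeval x g ∈ (LinearMap.range f)
    rw [Polynomial.aeval_eq_sum_range]
    refine Submodule.sum_mem _ fun i _ => ?_
    rw [← algebraMap_smul R]
    exact Submodule.smul_mem _ _ (hpow i)
  have hinj : Function.Injective (f.restrictScalars k) :=
    (LinearMap.injective_iff_surjective_of_finrank_eq_finrank
      (by rw [hdim, Module.finrank_pi_fintype]; simp)).2 hsurj
  refine ⟨Module.Basis.ofEquivFun (LinearEquiv.ofBijective f ⟨hinj, hsurj⟩).symm, fun i => ?_⟩
  rw [Module.Basis.coe_ofEquivFun]
  exact (Fintype.linearCombination_apply_single R _ i 1).trans (one_smul R _)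

/-- The group algebra of a finite cyclic group is generated by `σ - 1`. -/
theorem adjoin_of_sub_one_eq_top (k : Type*) {G : Type*} [Field k] [CommGroup G] [Finite G] (σ : G)
    (hgen : Subgroup.zpowers σ = ⊤) :
    Algebra.adjoin k {MonoidAlgebra.of k G σ - 1} = ⊤ := by
  have hσ : MonoidAlgebra.of k G σ ∈ Algebra.adjoin k {MonoidAlgebra.of k G σ - 1} := by
    simpa using add_mem (Algebra.self_mem_adjoin_singleton k (MonoidAlgebra.of k G σ - 1))
      (one_mem (Algebra.adjoin k {MonoidAlgebra.of k G σ - 1}))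
  refine eq_top_iff.2 fun s _ => ?_
  induction s using MonoidAlgebra.induction_on with
  | of g =>
    obtain ⟨n, rfl⟩ := mem_powers_iff_mem_zpowers.2 (hgen ▸ Subgroup.mem_top g :)
    simpa only [map_pow] using pow_mem hσ n
  | add a c ha hc => exact add_mem (ha trivial) (hc trivial)
  | smul a c hc => exact Subalgebra.smul_mem _ (hc trivial) a


/-- Let `k` be an algebraically closed field of characteristic `p`, `G` a cyclic group of
order `p ^ v` (`v ≥ 1`) with generator `σ`, `H = ⟨σ ^ p⟩` the subgroup of index `p`
generated by `τ = σ ^ p`, and for `0 ≤ m ≤ p ^ (v - 1)` let `W_m = k[H] / ((τ - 1) ^ m)`.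
For `1 ≤ j ≤ p ^ v` write `j = (l - 1)·p + j'` with `1 ≤ l ≤ p ^ (v - 1)` and
`1 ≤ j' ≤ p`.  Then the restriction of `V_j = k[G] / ((σ - 1) ^ j)` to `k[H]` (via the
ring homomorphism `k[H] → k[G]` induced by the inclusion `H ≤ G`) is isomorphic as a
`k[H]`-module to `W_l ^ ⊕ j' ⊕ W_{l-1} ^ ⊕ (p - j')`. -/
theorem restriction_of_cyclicIndecomposable
    (p : ℕ) (hp : p.Prime) (v : ℕ) (hv : 1 ≤ v)
    (k : Type) [Field k] [IsAlgClosed k] [CharP k p]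
    (G : Type) [CommGroup G] [Fintype G] (σ : G)
    (hcard : Fintype.card G = p ^ v) (hgen : Subgroup.zpowers σ = ⊤)
    (j l j' : ℕ) (hj1 : 1 ≤ j) (hj2 : j ≤ p ^ v)
    (hl1 : 1 ≤ l) (hl2 : l ≤ p ^ (v - 1)) (hj'1 : 1 ≤ j') (hj'2 : j' ≤ p)
    (hdecomp : j = (l - 1) * p + j') :
    ∃ e :
        (MonoidAlgebra k G ⧸ Ideal.span {(MonoidAlgebra.of k G σ - 1) ^ j}) ≃+
          ((Fin j' →
              (MonoidAlgebra k (Subgroup.zpowers (σ ^ p)) ⧸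
                Ideal.span
                  {(MonoidAlgebra.of k (Subgroup.zpowers (σ ^ p))
                      ⟨σ ^ p, Subgroup.mem_zpowers _⟩ - 1) ^ l})) ×
            (Fin (p - j') →
              (MonoidAlgebra k (Subgroup.zpowers (σ ^ p)) ⧸
                Ideal.span
                  {(MonoidAlgebra.of k (Subgroup.zpowers (σ ^ p))
                      ⟨σ ^ p, Subgroup.mem_zpowers _⟩ - 1) ^ (l - 1)}))),
      ∀ (a : MonoidAlgebra k (Subgroup.zpowers (σ ^ p)))
        (x : MonoidAlgebra k G ⧸ Ideal.span {(MonoidAlgebra.of k G σ - 1) ^ j}),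
        e (MonoidAlgebra.mapDomainRingHom k (Subgroup.zpowers (σ ^ p)).subtype a • x)
          = a • e x := by
  obtain ⟨q, rfl⟩ : ∃ q, l = q + 1 := ⟨l - 1, by omega⟩
  simp only [Nat.add_sub_cancel] at hdecomp ⊢
  subst hdecomp
  have : Fact p.Prime := ⟨hp⟩
  have : CharP (MonoidAlgebra k G) p := charP_of_injective_algebraMap' k p
  let φ := MonoidAlgebra.mapDomainRingHom k (Subgroup.zpowers (σ ^ p)).subtype
  let : Algebra (MonoidAlgebra k (Subgroup.zpowers (σ ^ p))) (MonoidAlgebra k G) := φ.toAlgebra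
  have : IsScalarTower k (MonoidAlgebra k (Subgroup.zpowers (σ ^ p))) (MonoidAlgebra k G) :=
    IsScalarTower.of_algebraMap_eq fun c => by
      simp [RingHom.algebraMap_toAlgebra, φ]
  have hord : orderOf σ = p ^ v := by
    rw [← Nat.card_zpowers, hgen, Subgroup.card_top, Nat.card_eq_fintype_card, hcard]
  have hH : Nat.card (Subgroup.zpowers (σ ^ p)) = p ^ (v - 1) := by
    rw [Nat.card_zpowers, orderOf_pow_of_dvd hp.ne_zero (hord ▸ dvd_pow_self p (by omega)), hord,
      Nat.pow_div hv hp.pos |>.symm, pow_one]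
  have hxy : algebraMap (MonoidAlgebra k (Subgroup.zpowers (σ ^ p))) (MonoidAlgebra k G)
      (MonoidAlgebra.of k _ ⟨σ ^ p, Subgroup.mem_zpowers _⟩ - 1)
        = (MonoidAlgebra.of k G σ - 1) ^ p := by
    rw [sub_pow_char, one_pow, ← map_pow]
    rw [RingHom.algebraMap_toAlgebra, map_sub, map_one]
    simp [φ]
  have hdim : Module.finrank k (MonoidAlgebra k G)
      = p * Module.finrank k (MonoidAlgebra k (Subgroup.zpowers (σ ^ p))) := by
    have h (M : Type) [Finite M] : Module.finrank k (MonoidAlgebra k M) = Nat.card M :=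
      Module.finrank_eq_nat_card_basis (MonoidAlgebra.basis M k)
    rw [h, h, hH, Nat.card_eq_fintype_card, hcard, ← pow_succ', Nat.sub_add_cancel hv]
  obtain ⟨b, hb⟩ := exists_basis_pow_of_finrank_eq (k := k) hp.pos _ _ hxy
    (adjoin_of_sub_one_eq_top k σ hgen) hdim
  obtain ⟨e⟩ := nonempty_quotient_span_pow_linearEquiv _ _ hxy b hb q j' hj'1 hj'2
  refine ⟨e.toAddEquiv, fun a x => ?_⟩
  change e (algebraMap (MonoidAlgebra k (Subgroup.zpowers (σ ^ p))) (MonoidAlgebra k G) a • x) = _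
  rw [algebraMap_smul]
  exact e.map_smul a x
end

section
/- Let 0 ≤ w ≤ v and let H be the unique subgroup of G of order p^w, generated by τ = σ^{p^{v-w}}; for 0 ≤ m ≤ p^w let W_m denote the k[H]-module k[H]/((τ - 1)^m). Then for every 1 ≤ l ≤ p^w, the induced module k[G] ⊗_{k[H]} W_l is isomorphic, as a k[G]-module, to V_{l·p^{v-w}}. -/
open scoped TensorProduct

/-- Base change of a cyclic module: `A ⊗[B] (B ⧸ (b))` is `A ⧸ (a)`, where `a` is the image of `b`. -/
theorem nonempty_tensorProduct_quotient_span_singleton_equiv {A B : Type*} [CommRing A]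
    [CommRing B] [Algebra B A] {b : B} {a : A} (h : algebraMap B A b = a) :
    Nonempty ((A ⊗[B] (B ⧸ Ideal.span {b})) ≃ₗ[A] (A ⧸ Ideal.span {a})) := by
  have e := (Algebra.TensorProduct.quotIdealMapEquivTensorQuot A (Ideal.span {b})).symm
  rw [Ideal.map_span, Set.image_singleton, h] at e
  exact ⟨e.toLinearEquiv⟩

/-- Let `k` be an algebraically closed field of characteristic `p`, `G` a cyclic group of
order `p ^ v` with generator `σ`, `0 ≤ w ≤ v`, and `H = ⟨σ ^ (p ^ (v - w))⟩` the unique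
subgroup of `G` of order `p ^ w`, generated by `τ = σ ^ (p ^ (v - w))`.  For
`0 ≤ m ≤ p ^ w` let `W_m = k[H] / ((τ - 1) ^ m)`.  Then for every `1 ≤ l ≤ p ^ w`,
the induced module `k[G] ⊗_{k[H]} W_l` is isomorphic as a `k[G]`-module to
`V_{l · p ^ (v - w)} = k[G] / ((σ - 1) ^ (l · p ^ (v - w)))`. -/
theorem induced_module_of_cyclicIndecomposable
    (p : ℕ) (hp : p.Prime) (v : ℕ) (hv : 1 ≤ v)
    (k : Type) [Field k] [IsAlgClosed k] [CharP k p]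
    (G : Type) [CommGroup G] [Fintype G] (σ : G)
    (hcard : Fintype.card G = p ^ v) (hgen : Subgroup.zpowers σ = ⊤)
    (w : ℕ) (hw : w ≤ v) (l : ℕ) (hl1 : 1 ≤ l) (hl2 : l ≤ p ^ w) :
    letI : Algebra (MonoidAlgebra k (Subgroup.zpowers (σ ^ p ^ (v - w))))
        (MonoidAlgebra k G) :=
      (MonoidAlgebra.mapDomainRingHom k (Subgroup.zpowers (σ ^ p ^ (v - w))).subtype).toAlgebra
    Nonempty
      ((MonoidAlgebra k G ⊗[MonoidAlgebra k (Subgroup.zpowers (σ ^ p ^ (v - w)))]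
          (MonoidAlgebra k (Subgroup.zpowers (σ ^ p ^ (v - w))) ⧸
            Ideal.span
              {(MonoidAlgebra.of k (Subgroup.zpowers (σ ^ p ^ (v - w)))
                  ⟨σ ^ p ^ (v - w), Subgroup.mem_zpowers _⟩ - 1) ^ l}))
        ≃ₗ[MonoidAlgebra k G]
          (MonoidAlgebra k G ⧸
            Ideal.span {(MonoidAlgebra.of k G σ - 1) ^ (l * p ^ (v - w))})) := by
  let : Algebra (MonoidAlgebra k (Subgroup.zpowers (σ ^ p ^ (v - w)))) (MonoidAlgebra k G) :=
    (MonoidAlgebra.mapDomainRingHom k (Subgroup.zpowers (σ ^ p ^ (v - w))).subtype).toAlgebra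
  have : Fact p.Prime := ⟨hp⟩
  have : CharP (MonoidAlgebra k G) p :=
    charP_of_injective_algebraMap (algebraMap k (MonoidAlgebra k G)).injective p
  refine nonempty_tensorProduct_quotient_span_singleton_equiv ?_
  rw [mul_comm l, pow_mul, sub_pow_char_pow, one_pow, ← map_pow, map_pow, map_sub, map_one,
    RingHom.algebraMap_toAlgebra]
  simp [MonoidAlgebra.of_apply]
end

section
/- Let 0 ≤ w ≤ v and let H be the unique subgroup of G of order p^w. A finitely generated k[G]-module V is relatively H-projective, i.e. a direct summand of an induced module k[G] ⊗_{k[H]} W for some finitely generated k[H]-module W, if and only if V is isomorphic to a finite direct sum of modules of the form V_{l·p^{v-w}} with 1 ≤ l ≤ p^w. -/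
open scoped TensorProduct

section TruncatedPolynomial

open Polynomial

/-- Membership in the ideals of a truncated polynomial ring is divisibility of lifts. -/
theorem map_mem_span_X_pow_iff {k A : Type*} [Field k] [CommRing A] (φ : k[X] →+* A)
    (hφ : Function.Surjective φ) {n : ℕ} (hker : RingHom.ker φ = Ideal.span {X ^ n})
    {d : ℕ} (hd : d ≤ n) (f : k[X]) : φ f ∈ Ideal.span {φ X ^ d} ↔ X ^ d ∣ f := by
  rw [Ideal.mem_span_singleton]
  constructor
  · rintro ⟨a, ha⟩
    obtain ⟨b, rfl⟩ := hφ a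
    have : f - X ^ d * b ∈ RingHom.ker φ := by simp [RingHom.mem_ker, ha]
    rw [hker, Ideal.mem_span_singleton] at this
    exact (dvd_sub_left (dvd_mul_right _ _)).1 ((pow_dvd_pow X hd).trans this)
  · intro h
    simpa using map_dvd φ h

/-- A finite module over a truncated polynomial ring is a finite direct sum of cyclic modules. -/
theorem exists_linearEquiv_pi_quotient_span_X_pow {k A M : Type*} [Field k] [CommRing A]
    [AddCommGroup M] [Module A M] [Module.Finite A M] (φ : k[X] →+* A)
    (hφ : Function.Surjective φ) {n : ℕ} (hker : RingHom.ker φ = Ideal.span {X ^ n}) :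
    ∃ (m : ℕ) (c : Fin m → ℕ), (∀ i, 1 ≤ c i ∧ c i ≤ n) ∧
      Nonempty (M ≃ₗ[A] ((i : Fin m) → A ⧸ Ideal.span {φ X ^ c i})) := by
  let : Algebra k[X] A := φ.toAlgebra
  let : Module k[X] M := Module.compHom M φ
  have : IsScalarTower k[X] A M := ⟨fun f a z => mul_smul (φ f) a z⟩
  have hsurj : Function.Surjective (algebraMap k[X] A) := hφ
  have : Module.Finite k[X] A := Module.Finite.of_surjective (Algebra.linearMap k[X] A) hsurj
  have : Module.Finite k[X] M := Module.Finite.trans A M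
  have hXn : φ (X ^ n) = 0 := by
    rw [← RingHom.mem_ker, hker]; exact Ideal.mem_span_singleton_self _
  have hkill (z : M) : (X ^ n : k[X]) • z = 0 := by
    change φ (X ^ n) • z = 0
    rw [hXn, zero_smul]
  obtain ⟨d, c, ⟨e⟩⟩ := Module.torsion_by_prime_power_decomposition
    (p := (X : k[X])) (M := M) Polynomial.irreducible_X (fun {z} => ⟨⟨X ^ n, n, rfl⟩, hkill z⟩)
  let e₁ : M ≃ₗ[k[X]] ((i : Fin d) → k[X] ⧸ Ideal.span {(X : k[X]) ^ c i}) :=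
    e.trans (DirectSum.linearEquivFunOnFintype _ _ _)
  have hc (i : Fin d) : c i ≤ n := by
    have h : (X ^ n : k[X]) • (Pi.single i 1 :
        (i : Fin d) → k[X] ⧸ Ideal.span {(X : k[X]) ^ c i}) = 0 := by
      rw [← e₁.apply_symm_apply (Pi.single i 1), ← map_smul, hkill, map_zero]
    have h := congrFun h i
    rw [Pi.smul_apply, Pi.single_eq_same] at h
    change Ideal.Quotient.mk (Ideal.span {(X : k[X]) ^ c i}) (X ^ n * 1) = 0 at h
    rw [mul_one, Ideal.Quotient.eq_zero_iff_mem, Ideal.mem_span_singleton] at h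
    exact (pow_dvd_pow_iff X_ne_zero not_isUnit_X).1 h
  have hQ (i : Fin d) : Nonempty
      ((k[X] ⧸ Ideal.span {(X : k[X]) ^ c i}) ≃ₗ[k[X]] (A ⧸ Ideal.span {φ X ^ c i})) := by
    let f : k[X] →ₗ[k[X]] (A ⧸ Ideal.span {φ X ^ c i}) :=
      ((Ideal.span {φ X ^ c i}).mkQ.restrictScalars k[X]).comp (Algebra.linearMap k[X] A)
    have hf : Function.Surjective f := (Submodule.mkQ_surjective _).comp hsurj
    have hk : LinearMap.ker f = Ideal.span {(X : k[X]) ^ c i} := by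
      ext g
      rw [LinearMap.mem_ker]
      change Ideal.Quotient.mk _ (φ g) = 0 ↔ _
      rw [Ideal.Quotient.eq_zero_iff_mem, map_mem_span_X_pow_iff φ hφ hker (hc i),
        Ideal.mem_span_singleton]
    exact ⟨(Submodule.quotEquivOfEq _ _ hk.symm).trans (f.quotKerEquivOfSurjective hf)⟩
  let e₂ : M ≃ₗ[k[X]] ((i : Fin d) → A ⧸ Ideal.span {φ X ^ c i}) :=
    e₁.trans (LinearEquiv.piCongrRight fun i => (hQ i).some)
  let e₃ : M ≃ₗ[A] ((i : Fin d) → A ⧸ Ideal.span {φ X ^ c i}) :=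
    e₂.extendScalarsOfSurjective hsurj
  let s : Fin (Fintype.card {i // c i ≠ 0}) ≃ {i // c i ≠ 0} := (Fintype.equivFin _).symm
  let r : ((i : Fin d) → A ⧸ Ideal.span {φ X ^ c i}) →ₗ[A]
      ((j : Fin (Fintype.card {i // c i ≠ 0})) → A ⧸ Ideal.span {φ X ^ c (s j)}) :=
    LinearMap.pi fun j => LinearMap.proj (s j).1
  have hr : Function.Bijective r := by
    constructor
    · intro a b hab
      ext i
      by_cases hi : c i = 0
      · have : Subsingleton (A ⧸ Ideal.span {φ X ^ c i}) := by
          rw [Ideal.Quotient.subsingleton_iff, hi, pow_zero, Ideal.span_singleton_one]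
        exact Subsingleton.elim _ _
      · obtain ⟨j, hj⟩ := s.surjective ⟨i, hi⟩
        obtain rfl : (s j).1 = i := by rw [hj]
        exact congrFun hab j
    · intro b
      have (i : Fin d) : ∃ a : A ⧸ Ideal.span {φ X ^ c i}, ∀ j (h : (s j).1 = i), h ▸ b j = a := by
        by_cases hi : c i = 0
        · exact ⟨0, fun j h => ((s j).2 (h ▸ hi)).elim⟩
        · obtain ⟨j, hj⟩ := s.surjective ⟨i, hi⟩
          obtain rfl : (s j).1 = i := by rw [hj]
          refine ⟨b j, fun j' h => ?_⟩
          obtain rfl : j' = j := s.injective (Subtype.ext h)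
          rfl
      choose a ha using this
      exact ⟨a, funext fun j => (ha _ j rfl).symm⟩
  exact ⟨_, fun j => c (s j), fun j => ⟨Nat.one_le_iff_ne_zero.2 (s j).2, hc _⟩,
    ⟨e₃.trans (LinearEquiv.ofBijective r hr)⟩⟩


/-- In a direct sum of cyclic modules whose lengths are multiples of `q`, an element of the form
`X ^ m • z` killed by `X` is divisible by `X ^ (m + 1)` unless `q` divides `m + 1`. -/
theorem exists_pow_smul_eq_pow_succ_smul {k A : Type*} [Field k] [CommRing A] (φ : k[X] →+* A)
    (hφ : Function.Surjective φ) {n : ℕ} (hker : RingHom.ker φ = Ideal.span {X ^ n})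
    {ι : Type*} {c : ι → ℕ} (hc : ∀ i, c i ≤ n) {q : ℕ} (hq : ∀ i, q ∣ c i)
    {m : ℕ} (hm : ¬ q ∣ m + 1) (z : (i : ι) → A ⧸ Ideal.span {φ X ^ c i})
    (hz : φ X ^ (m + 1) • z = 0) : ∃ u, φ X ^ m • z = φ X ^ (m + 1) • u := by
  suffices h : ∀ i, ∃ u, φ X ^ m • z i = φ X ^ (m + 1) • u by
    choose u hu using h
    exact ⟨u, funext hu⟩
  intro i
  have hzi : φ X ^ (m + 1) • z i = 0 := congrFun hz i
  obtain ⟨a, ha⟩ := Ideal.Quotient.mk_surjective (z i)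
  obtain ⟨f, rfl⟩ := hφ a
  rw [← ha] at hzi ⊢
  change Ideal.Quotient.mk _ (φ X ^ (m + 1) * φ f) = 0 at hzi
  have hφmul (j : ℕ) : φ X ^ j * φ f = φ (X ^ j * f) := by rw [map_mul, map_pow]
  rw [hφmul, Ideal.Quotient.eq_zero_iff_mem, map_mem_span_X_pow_iff φ hφ hker (hc i)] at hzi
  rcases le_or_gt (c i) m with hcm | hcm
  · refine ⟨0, ?_⟩
    rw [smul_zero]
    change Ideal.Quotient.mk _ (φ X ^ m * φ f) = 0
    rw [hφmul, Ideal.Quotient.eq_zero_iff_mem, map_mem_span_X_pow_iff φ hφ hker (hc i)]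
    exact (pow_dvd_pow X hcm).mul_right f
  · have hlt : m + 1 < c i := lt_of_le_of_ne hcm fun h => hm (h ▸ hq i)
    obtain ⟨g, rfl⟩ : X ∣ f := by
      have h : X ^ (m + 1) * X ∣ X ^ (m + 1) * f := (pow_dvd_pow X hlt).trans hzi
      exact (mul_dvd_mul_iff_left (pow_ne_zero _ X_ne_zero)).1 h
    refine ⟨Ideal.Quotient.mk _ (φ g), ?_⟩
    change Ideal.Quotient.mk _ (φ X ^ m * φ (X * g)) = Ideal.Quotient.mk _ (φ X ^ (m + 1) * φ g)
    rw [map_mul φ, pow_succ, mul_assoc]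

/-- A direct summand of a direct sum of cyclic modules whose lengths are multiples of `q` is again
a direct sum of such modules. -/
theorem exists_linearEquiv_pi_of_retract {k A M : Type*} [Field k] [CommRing A]
    [AddCommGroup M] [Module A M] [Module.Finite A M] (φ : k[X] →+* A)
    (hφ : Function.Surjective φ) {n : ℕ} (hker : RingHom.ker φ = Ideal.span {X ^ n})
    {ι : Type*} {c : ι → ℕ} (hc : ∀ i, c i ≤ n) {q : ℕ} (hq : ∀ i, q ∣ c i)
    (f : M →ₗ[A] ((i : ι) → A ⧸ Ideal.span {φ X ^ c i}))
    (g : ((i : ι) → A ⧸ Ideal.span {φ X ^ c i}) →ₗ[A] M) (hgf : g ∘ₗ f = LinearMap.id) :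
    ∃ (m : ℕ) (d : Fin m → ℕ), (∀ i, 1 ≤ d i ∧ d i ≤ n ∧ q ∣ d i) ∧
      Nonempty (M ≃ₗ[A] ((i : Fin m) → A ⧸ Ideal.span {φ X ^ d i})) := by
  obtain ⟨m, d, hd, ⟨e⟩⟩ := exists_linearEquiv_pi_quotient_span_X_pow (M := M) φ hφ hker
  refine ⟨m, d, fun i => ⟨(hd i).1, (hd i).2, ?_⟩, ⟨e⟩⟩
  by_contra hi
  obtain ⟨j, hj⟩ : ∃ j, d i = j + 1 := ⟨d i - 1, by have := (hd i).1; omega⟩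
  let z : (i : Fin m) → A ⧸ Ideal.span {φ X ^ d i} := Pi.single i 1
  have hz : φ X ^ (j + 1) • z = 0 := by
    rw [← Pi.single_smul, ← hj]
    convert Pi.single_zero i
    change Ideal.Quotient.mk _ (φ X ^ d i * 1) = 0
    rw [mul_one, Ideal.Quotient.eq_zero_iff_mem]
    exact Ideal.mem_span_singleton_self _
  obtain ⟨u, hu⟩ := exists_pow_smul_eq_pow_succ_smul φ hφ hker hc hq (hj ▸ hi) (f (e.symm z))
    (by rw [← map_smul, ← map_smul, hz, map_zero, map_zero])
  have hu := congrArg (fun y => e (g y)) hu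
  have hgf' (y : M) : g (f y) = y := LinearMap.congr_fun hgf y
  simp only [map_smul, hgf', LinearEquiv.apply_symm_apply] at hu
  have hu := congrFun hu i
  simp only [Pi.smul_apply, z, Pi.single_eq_same] at hu
  obtain ⟨b, hb⟩ := Ideal.Quotient.mk_surjective (e (g u) i)
  rw [← hb, ← hj] at hu
  change Ideal.Quotient.mk _ (φ X ^ j * 1) = Ideal.Quotient.mk _ (φ X ^ d i * b) at hu
  rw [Ideal.Quotient.eq_zero_iff_mem.2 (Ideal.mem_span_singleton.2 (dvd_mul_right _ b)), mul_one,
    Ideal.Quotient.eq_zero_iff_mem, ← map_pow φ X j, map_mem_span_X_pow_iff φ hφ hker (hd i).2,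
    pow_dvd_pow_iff X_ne_zero not_isUnit_X] at hu
  omega

/-- Base change of a direct sum of cyclic modules along an algebra in which `y` becomes a power
of `x`. -/
theorem nonempty_tensor_pi_quotient_linearEquiv {S R ι : Type*} [CommRing S] [CommRing R]
    [Algebra S R] [Finite ι] {y : S} {x : R} {q : ℕ} (hxy : algebraMap S R y = x ^ q)
    (c : ι → ℕ) :
    Nonempty (R ⊗[S] ((i : ι) → S ⧸ Ideal.span {y ^ c i}) ≃ₗ[R]
      ((i : ι) → R ⧸ Ideal.span {x ^ (c i * q)})) := by
  classical
  have := Fintype.ofFinite ι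
  have h (i : ι) : (Ideal.span {y ^ c i}).map (algebraMap S R) = Ideal.span {x ^ (c i * q)} := by
    rw [Ideal.map_span, Set.image_singleton, map_pow, hxy, ← pow_mul, mul_comm]
  exact ⟨(TensorProduct.piRight S R R _).trans (LinearEquiv.piCongrRight fun i =>
    (Algebra.TensorProduct.quotIdealMapEquivTensorQuot R
      (Ideal.span {y ^ c i})).toLinearEquiv.symm.trans
      (Submodule.quotEquivOfEq _ _ (h i)))⟩

/-- The group algebra of a cyclic `p`-group in characteristic `p` is a truncated polynomial
ring. -/
theorem aeval_of_sub_one_surjective_and_ker {p : ℕ} (hp : p.Prime) {k G : Type*} [Field k]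
    [CharP k p] [CommGroup G] {a : ℕ} (hcard : Nat.card G = p ^ a) {g : G}
    (hg : Subgroup.zpowers g = ⊤) :
    Function.Surjective (aeval (R := k) (MonoidAlgebra.of k G g - 1)).toRingHom ∧
      RingHom.ker (aeval (R := k) (MonoidAlgebra.of k G g - 1)).toRingHom =
        Ideal.span {X ^ p ^ a} := by
  have := Fact.mk hp
  have : Finite G := Nat.finite_of_card_ne_zero (hcard ▸ pow_ne_zero _ hp.ne_zero)
  have : Fintype G := Fintype.ofFinite G
  have : CharP (MonoidAlgebra k G) p := charP_of_injective_algebraMap' k p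
  let φ : k[X] →ₐ[k] MonoidAlgebra k G := aeval (MonoidAlgebra.of k G g - 1)
  have hsurj : Function.Surjective φ := by
    intro z
    rw [← AlgHom.mem_range]
    induction z using MonoidAlgebra.induction_on with
    | of h =>
      obtain ⟨i, rfl⟩ := (mem_powers_iff_mem_zpowers.2 (hg ▸ Subgroup.mem_top h) :
        h ∈ Submonoid.powers g)
      exact ⟨(X + 1) ^ i, by simp [φ]⟩
    | add x y hx hy => exact add_mem hx hy
    | smul r x hx => exact Subalgebra.smul_mem _ hx r
  refine ⟨hsurj, ?_⟩
  have hX : (X ^ p ^ a : k[X]) ∈ RingHom.ker φ := by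
    rw [RingHom.mem_ker, map_pow, aeval_X, sub_pow_char_pow, one_pow, ← map_pow, ← hcard,
      pow_card_eq_one', map_one, sub_self]
  obtain ⟨f, hf⟩ := IsPrincipalIdealRing.principal (RingHom.ker φ)
  change RingHom.ker φ = Ideal.span {f} at hf
  change RingHom.ker φ = _
  rw [hf, Ideal.mem_span_singleton] at hX
  obtain ⟨j, hj, hfj⟩ := (dvd_prime_pow prime_X _).1 hX
  rw [Ideal.span_singleton_eq_span_singleton.2 hfj] at hf
  have hdim : Module.finrank k (k[X] ⧸ RingHom.ker φ) = p ^ a := by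
    rw [(Ideal.quotientKerAlgEquivOfSurjective hsurj).toLinearEquiv.finrank_eq, ← hcard,
      Nat.card_eq_fintype_card]
    exact Module.finrank_eq_card_basis (MonoidAlgebra.basis G k)
  rw [hf, finrank_quotient_span_eq_natDegree, natDegree_X_pow] at hdim
  rw [hf, hdim]

/-- Relative projectivity for an extension `S → R` of truncated polynomial rings in which the
variable of `S` is mapped to the `q`-th power of the variable of `R`. -/
theorem exists_summand_baseChange_iff {k S R V : Type} [Field k] [CommRing S] [CommRing R]
    [Algebra S R] [AddCommGroup V] [Module R V] [Module.Finite R V]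
    {φ : k[X] →+* S} (hφ : Function.Surjective φ) {n : ℕ}
    (hφk : RingHom.ker φ = Ideal.span {X ^ n})
    {ψ : k[X] →+* R} (hψ : Function.Surjective ψ) {q : ℕ} (hq : 0 < q)
    (hψk : RingHom.ker ψ = Ideal.span {X ^ (n * q)})
    (hφψ : algebraMap S R (φ X) = ψ X ^ q) :
    (∃ (W : ModuleCat.{0} S) (N N' : Submodule R (R ⊗[S] W)),
        Module.Finite S W ∧ IsCompl N N' ∧ Nonempty (V ≃ₗ[R] N)) ↔
      ∃ (m : ℕ) (c : Fin m → ℕ), (∀ i, 1 ≤ c i ∧ c i ≤ n) ∧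
        Nonempty (V ≃ₗ[R] ((i : Fin m) → R ⧸ Ideal.span {ψ X ^ (c i * q)})) := by
  constructor
  · rintro ⟨W, N, N', hW, hN, ⟨e⟩⟩
    obtain ⟨m, c, hc, ⟨eW⟩⟩ := exists_linearEquiv_pi_quotient_span_X_pow (M := W) φ hφ hφk
    obtain ⟨eT⟩ := nonempty_tensor_pi_quotient_linearEquiv hφψ c
    let E : R ⊗[S] W ≃ₗ[R] ((i : Fin m) → R ⧸ Ideal.span {ψ X ^ (c i * q)}) :=
      (eW.baseChange S R _ _).trans eT
    obtain ⟨m', d, hd, ⟨eV⟩⟩ := exists_linearEquiv_pi_of_retract ψ hψ hψk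
      (fun i => Nat.mul_le_mul_right q (hc i).2) (fun i => dvd_mul_left q (c i))
      (E.toLinearMap ∘ₗ N.subtype ∘ₗ e.toLinearMap)
      (e.symm.toLinearMap ∘ₗ N.projectionOnto N' hN ∘ₗ E.symm.toLinearMap)
      (by ext z; simp)
    choose d' hd' using fun i => (hd i).2.2
    obtain rfl : d = fun i => d' i * q := funext fun i => (hd' i).trans (mul_comm _ _)
    exact ⟨m', d', fun i => ⟨Nat.pos_of_mul_pos_right (hd i).1,
      Nat.le_of_mul_le_mul_right (hd i).2.1 hq⟩, ⟨eV⟩⟩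
  · rintro ⟨m, c, -, ⟨e⟩⟩
    obtain ⟨eT⟩ := nonempty_tensor_pi_quotient_linearEquiv hφψ c
    exact ⟨ModuleCat.of S ((i : Fin m) → S ⧸ Ideal.span {φ X ^ c i}), ⊤, ⊥,
      inferInstanceAs (Module.Finite S ((i : Fin m) → S ⧸ Ideal.span {φ X ^ c i})), isCompl_top_bot,
      ⟨(e.trans eT.symm).trans Submodule.topEquiv.symm⟩⟩

end TruncatedPolynomial

/-- Let `k` be an algebraically closed field of characteristic `p`, `G` a cyclic group of
order `p ^ v` with generator `σ`, `0 ≤ w ≤ v`, and `H = ⟨σ ^ (p ^ (v - w))⟩` the unique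
subgroup of `G` of order `p ^ w`.  A finitely generated `k[G]`-module `V` is relatively
`H`-projective — i.e. a direct summand of an induced module `k[G] ⊗_{k[H]} W` for some
finitely generated `k[H]`-module `W` — if and only if `V` is isomorphic to a finite
direct sum of modules `V_{l · p ^ (v - w)} = k[G] / ((σ - 1) ^ (l · p ^ (v - w)))` with
`1 ≤ l ≤ p ^ w`. -/
theorem relatively_projective_iff_direct_sum_of_cyclicIndecomposables
    (p : ℕ) (hp : p.Prime) (v : ℕ) (hv : 1 ≤ v)
    (k : Type) [Field k] [IsAlgClosed k] [CharP k p]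
    (G : Type) [CommGroup G] [Fintype G] (σ : G)
    (hcard : Fintype.card G = p ^ v) (hgen : Subgroup.zpowers σ = ⊤)
    (w : ℕ) (hw : w ≤ v)
    (V : Type) [AddCommGroup V] [Module (MonoidAlgebra k G) V]
    [Module.Finite (MonoidAlgebra k G) V] :
    letI : Algebra (MonoidAlgebra k (Subgroup.zpowers (σ ^ p ^ (v - w))))
        (MonoidAlgebra k G) :=
      (MonoidAlgebra.mapDomainRingHom k (Subgroup.zpowers (σ ^ p ^ (v - w))).subtype).toAlgebra
    ((∃ (W : ModuleCat.{0} (MonoidAlgebra k (Subgroup.zpowers (σ ^ p ^ (v - w)))))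
        (N N' : Submodule (MonoidAlgebra k G)
          (MonoidAlgebra k G ⊗[MonoidAlgebra k (Subgroup.zpowers (σ ^ p ^ (v - w)))] W)),
        Module.Finite (MonoidAlgebra k (Subgroup.zpowers (σ ^ p ^ (v - w)))) W ∧
        IsCompl N N' ∧ Nonempty (V ≃ₗ[MonoidAlgebra k G] N)) ↔
      (∃ (n : ℕ) (c : Fin n → ℕ),
        (∀ i, 1 ≤ c i ∧ c i ≤ p ^ w) ∧
        Nonempty (V ≃ₗ[MonoidAlgebra k G]
          ((i : Fin n) →
            MonoidAlgebra k G ⧸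
              Ideal.span {(MonoidAlgebra.of k G σ - 1) ^ (c i * p ^ (v - w))})))) := by
  have := Fact.mk hp
  have hord : orderOf σ = p ^ v := by
    rw [← Nat.card_zpowers, hgen, Subgroup.card_top, Nat.card_eq_fintype_card, hcard]
  have hpv : p ^ v = p ^ w * p ^ (v - w) := by rw [← pow_add, Nat.add_sub_cancel' hw]
  have hcardH : Nat.card (Subgroup.zpowers (σ ^ p ^ (v - w))) = p ^ w := by
    rw [Nat.card_zpowers, orderOf_pow, hord, Nat.gcd_eq_right (hpv ▸ dvd_mul_left _ _), hpv,
      Nat.mul_div_cancel _ (pow_pos hp.pos _)]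
  let τ : Subgroup.zpowers (σ ^ p ^ (v - w)) := ⟨σ ^ p ^ (v - w), Subgroup.mem_zpowers _⟩
  have hτ : Subgroup.zpowers τ = ⊤ := by
    refine Subgroup.eq_top_of_card_eq _ ?_
    rw [hcardH, Nat.card_zpowers, ← hcardH, Nat.card_zpowers, ← Subgroup.orderOf_coe]
  have : CharP (MonoidAlgebra k G) p := charP_of_injective_algebraMap' k p
  obtain ⟨hφ, hφk⟩ := aeval_of_sub_one_surjective_and_ker (k := k) hp hcardH hτ
  obtain ⟨hψ, hψk⟩ := aeval_of_sub_one_surjective_and_ker (k := k) hp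
    (Nat.card_eq_fintype_card.trans hcard) hgen
  let : Algebra (MonoidAlgebra k (Subgroup.zpowers (σ ^ p ^ (v - w)))) (MonoidAlgebra k G) :=
    (MonoidAlgebra.mapDomainRingHom k (Subgroup.zpowers (σ ^ p ^ (v - w))).subtype).toAlgebra
  have h := exists_summand_baseChange_iff (V := V) hφ hφk hψ (pow_pos hp.pos (v - w))
    (hpv ▸ hψk) (by
      change MonoidAlgebra.mapDomainRingHom k _ (Polynomial.aeval _ Polynomial.X) =
        (Polynomial.aeval _ Polynomial.X) ^ _
      rw [Polynomial.aeval_X, Polynomial.aeval_X, sub_pow_char_pow, map_sub, map_one,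
        one_pow, ← map_pow]
      simp [τ])
  have hX : (Polynomial.aeval (R := k) (MonoidAlgebra.of k G σ - 1)).toRingHom
      Polynomial.X = MonoidAlgebra.of k G σ - 1 := Polynomial.aeval_X _
  rw [hX] at h
  exact h
end

section
/- For every finitely generated k[G]-module V there is an isomorphism of k[G]-modules V / soc(V) ≅ rad(V), where soc(V) denotes the sum of all simple k[G]-submodules of V and rad(V) denotes the intersection of all maximal k[G]-submodules of V (the radical of V). -/
/-- The socle of a module: the sum of all simple (atomic) submodules. -/
def moduleSocle (R : Type*) [Ring R] (V : Type*) [AddCommGroup V] [Module R V] :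
    Submodule R V :=
  sSup {W : Submodule R V | IsAtom W}

/-- The radical of a module: the intersection of all maximal (coatomic) submodules. -/
def moduleRadical (R : Type*) [Ring R] (V : Type*) [AddCommGroup V] [Module R V] :
    Submodule R V :=
  sInf {W : Submodule R V | IsCoatom W}

/-- A module killed by the Jacobson radical of a semiprimary ring is semisimple. -/
theorem IsSemiprimaryRing.isSemisimpleModule_of_isTorsionBySet_jacobson
    {R M : Type*} [Ring R] [IsSemiprimaryRing R] [AddCommGroup M] [Module R M]
    (h : Module.IsTorsionBySet R M (Ring.jacobson R)) : IsSemisimpleModule R M := by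
  let _ := h.module
  exact h.isSemisimpleModule_iff.1 inferInstance

/-- Over a semiprimary ring, the radical of `V` is `J • V` with `J` the Jacobson radical. -/
theorem moduleRadical_eq_jacobson_smul_top
    {R V : Type*} [Ring R] [IsSemiprimaryRing R] [AddCommGroup V] [Module R V] :
    moduleRadical R V = Ring.jacobson R • (⊤ : Submodule R V) := by
  refine le_antisymm (Module.jacobson_le_of_eq_bot ?_) (Ring.jacobson_smul_top_le R V)
  have : IsSemisimpleModule R (V ⧸ Ring.jacobson R • (⊤ : Submodule R V)) := by
    refine IsSemiprimaryRing.isSemisimpleModule_of_isTorsionBySet_jacobson ?_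
    rw [Module.isTorsionBySet_quotient_iff]
    exact fun v r hr ↦ Submodule.smul_mem_smul hr trivial
  exact IsSemisimpleModule.jacobson_eq_bot R _

/-- Over a commutative semiprimary ring, the socle of `V` is the submodule of elements
killed by the Jacobson radical. -/
theorem moduleSocle_eq_torsionBySet_jacobson
    {R V : Type*} [CommRing R] [IsSemiprimaryRing R] [AddCommGroup V] [Module R V] :
    moduleSocle R V = Submodule.torsionBySet R V (Ring.jacobson R) := by
  refine le_antisymm (sSup_le fun W hW v hv ↦ ?_) ?_
  · have : IsSimpleModule R W := isSimpleModule_iff_isAtom.2 hW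
    rw [Submodule.mem_torsionBySet_iff]
    intro r
    have h := IsSemisimpleModule.jacobson_le_annihilator R W r.2
    simpa using congrArg Subtype.val (Module.mem_annihilator.1 h ⟨v, hv⟩)
  · have : IsSemisimpleModule R (Submodule.torsionBySet R V (Ring.jacobson R : Set R)) :=
      IsSemiprimaryRing.isSemisimpleModule_of_isTorsionBySet_jacobson
        (Submodule.torsionBySet_isTorsionBySet _)
    rw [← Submodule.range_subtype (Submodule.torsionBySet R V _), LinearMap.range_eq_map,
      Submodule.map_le_iff_le_comap, ← IsSemisimpleModule.sSup_simples_eq_top]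
    refine sSup_le fun W (hW : IsSimpleModule R W) ↦ Submodule.map_le_iff_le_comap.1 (le_sSup ?_)
    exact isSimpleModule_iff_isAtom.1 <|
      .congr (W.equivMapOfInjective _ (Submodule.injective_subtype _)).symm

/-- If the Jacobson radical of a commutative semiprimary ring is principal, then
`V / soc(V) ≅ rad(V)` for every module `V`. -/
theorem nonempty_quotient_moduleSocle_equiv_moduleRadical
    {R V : Type*} [CommRing R] [IsSemiprimaryRing R] [AddCommGroup V] [Module R V]
    (hJ : (Ring.jacobson R).IsPrincipal) :
    Nonempty ((V ⧸ moduleSocle R V) ≃ₗ[R] moduleRadical R V) := by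
  obtain ⟨t, ht⟩ := hJ
  have hsoc : moduleSocle R V = LinearMap.ker (LinearMap.lsmul R V t) := by
    rw [moduleSocle_eq_torsionBySet_jacobson, ht, Submodule.torsionBySet_span_singleton_eq]
    rfl
  have hrad : moduleRadical R V = LinearMap.range (LinearMap.lsmul R V t) := by
    rw [moduleRadical_eq_jacobson_smul_top, ht]
    refine (Submodule.ideal_span_singleton_smul t ⊤).trans ?_
    exact Submodule.map_top _
  exact ⟨Submodule.quotEquivOfEq _ _ hsoc ≪≫ₗ (LinearMap.lsmul R V t).quotKerEquivRange ≪≫ₗ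
    LinearEquiv.ofEq _ _ hrad.symm⟩

/-- The group algebra of a finite cyclic group over a field is a principal ideal ring. -/
theorem MonoidAlgebra.isPrincipalIdealRing_of_isCyclic
    (k G : Type*) [Field k] [CommGroup G] [Finite G] [IsCyclic G] :
    IsPrincipalIdealRing (MonoidAlgebra k G) := by
  obtain ⟨g, hg⟩ := IsCyclic.exists_monoid_generator (α := G)
  refine IsPrincipalIdealRing.of_surjective (Polynomial.aeval (R := k) (MonoidAlgebra.of k G g))
    fun x ↦ ?_
  induction x using MonoidAlgebra.induction_on with
  | of h =>
    obtain ⟨n, rfl⟩ := Submonoid.mem_powers_iff _ _ |>.1 (hg h)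
    exact ⟨Polynomial.X ^ n, by simp only [map_pow, Polynomial.aeval_X]⟩
  | add x y hx hy =>
    obtain ⟨a, rfl⟩ := hx
    obtain ⟨b, rfl⟩ := hy
    exact ⟨a + b, map_add _ a b⟩
  | smul r x hx =>
    obtain ⟨a, rfl⟩ := hx
    exact ⟨r • a, map_smul _ r a⟩


/-- Let `k` be an algebraically closed field of positive characteristic `p` and `G` a
finite cyclic group.  For every finitely generated `k[G]`-module `V` there is an
isomorphism of `k[G]`-modules `V / soc(V) ≅ rad(V)`. -/
theorem quotient_socle_iso_radical
    (p : ℕ) (hp : p ≠ 0) (k : Type) [Field k] [IsAlgClosed k] [CharP k p]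
    (G : Type) [CommGroup G] [Fintype G] [IsCyclic G]
    (V : Type) [AddCommGroup V] [Module (MonoidAlgebra k G) V]
    [Module.Finite (MonoidAlgebra k G) V] :
    Nonempty ((V ⧸ moduleSocle (MonoidAlgebra k G) V)
      ≃ₗ[MonoidAlgebra k G] moduleRadical (MonoidAlgebra k G) V) := by
  have := MonoidAlgebra.isPrincipalIdealRing_of_isCyclic k G
  have : IsArtinianRing (MonoidAlgebra k G) := IsArtinianRing.of_finite k _
  exact nonempty_quotient_moduleSocle_equiv_moduleRadical
    (IsPrincipalIdealRing.principal (Ring.jacobson (MonoidAlgebra k G)))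
end
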